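/- arXiv:1009.1926 — 2 statements merged into one kernel-verified Lean document; each statement's English description precedes it below -/
import Mathlib

section
/- (Theorem 1, distributional robustness of the Bayes factor.) Let n and p be positive integers with n > p+1, let X_F be a real n×p matrix of rank p whose columns are orthogonal to 1_n, and let X_γ be the n×q_γ submatrix formed by a nonempty subset of the columns of X_F (1 ≤ q_γ ≤ p). Let y ∈ ℝⁿ satisfy y − ȳ1_n ≠ 0 and y − ȳ1_n not in the column space of X_F. Let f : (0,∞) → [0,∞) be measurable with ∫_{ℝⁿ} f(‖x‖²) dx = 1, let 0 < ν < q_γ, and assume ∫_{ℝⁿ} ‖x‖^ν f(‖x‖²) dx < ∞. Then the Bayes factor under the sub-harmonic priors, M_f(y|ν; X_γ) / M_f(y|ν; X_F), does not depend on f and equals [∫₀^∞ g^{ν/2−1} (1+g)^{(n−q_γ−1)/2} (g(1−R_γ²)+1)^{−(n−1)/2} dg] / [∫₀^∞ g^{ν/2−1} (1+g)^{(n−p−1)/2} (g(1−R_F²)+1)^{−(n−1)/2} dg], where R_γ² and R_F² are the coefficients of determination of the models with designs X_γ and X_F respectively. -/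
open MeasureTheory Matrix ENNReal

/-- The marginal density of `y` under model with design `X` and the sub-harmonic prior,
for spherically symmetric error density `x ↦ f(‖x‖²)`. -/
noncomputable def subharmonicMarginal (n : ℕ) {ι : Type} [Fintype ι] [DecidableEq ι]
    (X : Matrix (Fin n) ι ℝ) (y : Fin n → ℝ) (ν : ℝ) (f : ℝ → ℝ) : ℝ≥0∞ :=
  ∫⁻ α : ℝ, ∫⁻ β : ι → ℝ, ∫⁻ η in Set.Ioi (0:ℝ),
    ENNReal.ofReal (η ^ ((n : ℝ) / 2) * f (η * ∑ i, (y i - α - X.mulVec β i) ^ 2)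
      * (Real.Gamma (((Fintype.card ι : ℝ) - ν) / 2)
          / (2 ^ (ν / 2) * Real.pi ^ ((Fintype.card ι : ℝ) / 2)))
      * (Xᵀ * X).det ^ ((1:ℝ) / 2)
      * (β ⬝ᵥ (Xᵀ * X).mulVec β) ^ (-((Fintype.card ι : ℝ) - ν) / 2)
      * η ^ (ν / 2 - 1))

/-- The `ν`-th absolute moment `E_f = ∫_{ℝⁿ} ‖x‖^ν f(‖x‖²) dx`. -/
noncomputable def nuMoment (n : ℕ) (ν : ℝ) (f : ℝ → ℝ) : ℝ≥0∞ :=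
  ∫⁻ x : EuclideanSpace ℝ (Fin n), ENNReal.ofReal (‖x‖ ^ ν * f (‖x‖ ^ 2))

/-- The coefficient of determination `R² = ‖X(XᵀX)⁻¹Xᵀ(y-ȳ1)‖²/‖y-ȳ1‖²`. -/
noncomputable def coeffDet (n : ℕ) {ι : Type} [Fintype ι] [DecidableEq ι]
    (X : Matrix (Fin n) ι ℝ) (y : Fin n → ℝ) : ℝ :=
  (∑ i, (X.mulVec ((Xᵀ * X)⁻¹.mulVec (Xᵀ.mulVec (fun j => y j - (∑ l, y l) / n))) i) ^ 2)
    / (∑ i, (y i - (∑ l, y l) / n) ^ 2)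

theorem lintegral_comp_rpow_Ioi (g : ℝ → ℝ≥0∞) {p : ℝ} (hp : p ≠ 0) :
    ∫⁻ x in Set.Ioi (0:ℝ), ENNReal.ofReal (|p| * x ^ (p - 1)) * g (x ^ p)
      = ∫⁻ x in Set.Ioi (0:ℝ), g x := by
  have a : (· ^ p) '' (Set.Ioi 0) = Set.Ioi (0 : ℝ) := by
    ext1 x
    rw [Set.mem_image]
    constructor
    · rintro ⟨y, hy, rfl⟩
      exact Real.rpow_pos_of_pos hy p
    · exact fun hx ↦ ⟨x ^ (1 / p), Real.rpow_pos_of_pos hx _, by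
        simp [← Real.rpow_mul (le_of_lt hx), hp]⟩
  have := lintegral_image_eq_lintegral_abs_deriv_mul measurableSet_Ioi
    (fun x hx ↦ (Real.hasDerivAt_rpow_const
      (Or.inl (Set.mem_Ioi.mp hx).ne')).hasDerivWithinAt)
    ((Real.rpow_left_injOn hp).mono (by grind)) g
  rw [a] at this
  rw [this]
  refine setLIntegral_congr_fun measurableSet_Ioi (fun x hx ↦ ?_)
  rw [abs_mul, abs_of_nonneg (Real.rpow_nonneg (le_of_lt hx) (p - 1))]

theorem lintegral_comp_mul_left_Ioi (g : ℝ → ℝ≥0∞) {a : ℝ} (ha : 0 < a) :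
    ∫⁻ x in Set.Ioi (0:ℝ), ENNReal.ofReal a * g (a * x) = ∫⁻ x in Set.Ioi (0:ℝ), g x := by
  have h : (a * ·) '' (Set.Ioi 0) = Set.Ioi (0 : ℝ) := by
    rw [Set.image_mul_left_Ioi ha, mul_zero]
  have := lintegral_image_eq_lintegral_abs_deriv_mul measurableSet_Ioi
    (fun x (_ : x ∈ Set.Ioi (0:ℝ)) ↦ ((hasDerivAt_id x).const_mul a).hasDerivWithinAt)
    (mul_right_injective₀ ha.ne').injOn g
  simp only [id] at this
  rw [h] at this
  rw [this]
  simp [abs_of_pos ha]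

theorem lintegral_rpow_mul_comp_mul_Ioi (f : ℝ → ℝ) (s : ℝ) {A : ℝ} (hA : 0 < A) :
    ∫⁻ t in Set.Ioi (0:ℝ), ENNReal.ofReal (t ^ (s - 1) * f (t * A))
      = ENNReal.ofReal (A ^ (-s))
        * ∫⁻ t in Set.Ioi (0:ℝ), ENNReal.ofReal (t ^ (s - 1) * f t) := by
  rw [← lintegral_comp_mul_left_Ioi (fun t => ENNReal.ofReal (t ^ (s - 1) * f t)) hA,
    ← lintegral_const_mul' _ _ ENNReal.ofReal_ne_top]
  refine setLIntegral_congr_fun measurableSet_Ioi (fun x hx ↦ ?_)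
  have hx : 0 < x := hx
  rw [← ENNReal.ofReal_mul hA.le, ← ENNReal.ofReal_mul (by positivity),
    Real.mul_rpow hA.le hx.le, Real.rpow_sub_one hA.ne', Real.rpow_neg hA.le, mul_comm x A]
  congr 1
  have : A ^ s ≠ 0 := by positivity
  field_simp

theorem lintegral_rpow_mul_exp_neg_mul_Ioi {a r : ℝ} (ha : 0 < a) (hr : 0 < r) :
    ∫⁻ t in Set.Ioi (0:ℝ), ENNReal.ofReal (t ^ (a - 1) * Real.exp (-(r * t)))
      = ENNReal.ofReal (r ^ (-a) * Real.Gamma a) := by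
  have h := Real.integral_rpow_mul_exp_neg_mul_Ioi ha hr
  rw [one_div, Real.inv_rpow hr.le, ← Real.rpow_neg hr.le] at h
  rw [← h, ofReal_integral_eq_lintegral_ofReal]
  · have := Real.Gamma_pos_of_pos ha
    exact .of_integral_ne_zero (by rw [h]; positivity)
  · filter_upwards [ae_restrict_mem measurableSet_Ioi] with t ht
    have : 0 < t := ht
    positivity

theorem lintegral_rpow_mul_exp_neg_div_Ioi {a r : ℝ} (ha : 0 < a) (hr : 0 < r) :
    ∫⁻ t in Set.Ioi (0:ℝ), ENNReal.ofReal (t ^ (-a - 1) * Real.exp (-(r / t)))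
      = ENNReal.ofReal (r ^ (-a) * Real.Gamma a) := by
  rw [← lintegral_rpow_mul_exp_neg_mul_Ioi ha hr,
    ← lintegral_comp_rpow_Ioi
      (fun t => ENNReal.ofReal (t ^ (a - 1) * Real.exp (-(r * t)))) (p := -1) (by norm_num)]
  refine setLIntegral_congr_fun measurableSet_Ioi (fun x hx ↦ ?_)
  have hx : 0 < x := hx
  rw [← ENNReal.ofReal_mul (by positivity), Real.rpow_neg_one, Real.inv_rpow hx.le,
    ← Real.rpow_neg hx.le, abs_neg, abs_one, one_mul, ← mul_assoc, ← Real.rpow_add hx,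
    div_eq_mul_inv]
  ring_nf
  
theorem lintegral_lintegral_lintegral_lintegral_swap {A B C D : Type*} [MeasurableSpace A]
    [MeasurableSpace B] [MeasurableSpace C] [MeasurableSpace D]
    (μ : Measure A) (ν : Measure B) (ρ : Measure C) (σ : Measure D)
    [SFinite μ] [SFinite ν] [SFinite ρ] [SFinite σ]
    (F : A → B → C → D → ℝ≥0∞)
    (hF : Measurable fun z : A × B × C × D => F z.1 z.2.1 z.2.2.1 z.2.2.2) :
    ∫⁻ a, ∫⁻ b, ∫⁻ c, ∫⁻ d, F a b c d ∂σ ∂ρ ∂ν ∂μ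
      = ∫⁻ d, ∫⁻ c, ∫⁻ a, ∫⁻ b, F a b c d ∂ν ∂μ ∂ρ ∂σ := by
  let G : (A × B) → (C × D) → ℝ≥0∞ := fun x y => F x.1 x.2 y.1 y.2
  have hG : Measurable (Function.uncurry G) :=
    hF.comp (by fun_prop : Measurable fun w : (A × B) × (C × D) => (w.1.1, w.1.2, w.2.1, w.2.2))
  calc
    _ = ∫⁻ x, ∫⁻ y, G x y ∂(ρ.prod σ) ∂(μ.prod ν) := by
      rw [lintegral_prod (fun x => ∫⁻ y, G x y ∂(ρ.prod σ))
        (Measurable.lintegral_prod_right' (f := Function.uncurry G) hG).aemeasurable]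
      refine lintegral_congr fun a => lintegral_congr fun b => ?_
      rw [lintegral_prod _ (by fun_prop)]
    _ = ∫⁻ y, ∫⁻ x, G x y ∂(μ.prod ν) ∂(ρ.prod σ) := lintegral_lintegral_swap hG.aemeasurable
    _ = _ := by
      rw [lintegral_prod_symm (fun y => ∫⁻ x, G x y ∂(μ.prod ν))
        (Measurable.lintegral_prod_left' (f := Function.uncurry G) hG).aemeasurable]
      refine lintegral_congr fun d => lintegral_congr fun c => ?_
      rw [lintegral_prod _ (by fun_prop)]

/-- Polar coordinates for the lower Lebesgue integral of a radial function. -/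
theorem lintegral_fun_norm_addHaar {E : Type*} [NormedAddCommGroup E] [NormedSpace ℝ E]
    [FiniteDimensional ℝ E] [MeasurableSpace E] [BorelSpace E] [Nontrivial E]
    (μ : Measure E) [μ.IsAddHaarMeasure] {g : ℝ → ℝ≥0∞} (hg : Measurable g) :
    ∫⁻ x, g ‖x‖ ∂μ = Module.finrank ℝ E * μ (Metric.ball 0 1)
      * ∫⁻ r in Set.Ioi (0:ℝ), ENNReal.ofReal (r ^ (Module.finrank ℝ E - 1)) * g r :=
  calc
    ∫⁻ x, g ‖x‖ ∂μ = ∫⁻ x : ({(0)}ᶜ : Set E), g ‖x.1‖ ∂(μ.comap (↑)) := by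
      rw [lintegral_subtype_comap (measurableSet_singleton _).compl fun x ↦ g ‖x‖,
        restrict_compl_singleton]
    _ = ∫⁻ x, g x.2 ∂μ.toSphere.prod (.volumeIoiPow (Module.finrank ℝ E - 1)) := by
      simpa using μ.measurePreserving_homeomorphUnitSphereProd.lintegral_comp_emb
        (Homeomorph.measurableEmbedding _) (g ∘ Subtype.val ∘ Prod.snd)
    _ = μ.toSphere Set.univ
        * ∫⁻ r : Set.Ioi (0:ℝ), g r ∂.volumeIoiPow (Module.finrank ℝ E - 1) := by
      rw [lintegral_prod _ (by fun_prop)]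
      simp only [lintegral_const, mul_comm]
    _ = _ := by
      rw [Measure.volumeIoiPow, lintegral_withDensity_eq_lintegral_mul _ (by fun_prop)
        (by fun_prop), μ.toSphere_apply_univ]
      congr 1
      exact lintegral_subtype_comap measurableSet_Ioi
        fun r => ENNReal.ofReal (r ^ (Module.finrank ℝ E - 1)) * g r

theorem nuMoment_eq {n : ℕ} (hn : 0 < n) {ν : ℝ} {f : ℝ → ℝ} (hf : Measurable f) :
    nuMoment n ν f = n * volume (Metric.ball (0 : EuclideanSpace ℝ (Fin n)) 1) * (2⁻¹
      * ∫⁻ t in Set.Ioi (0:ℝ), ENNReal.ofReal (t ^ (((n : ℝ) + ν) / 2 - 1) * f t)) := by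
  have : Nonempty (Fin n) := ⟨⟨0, hn⟩⟩
  rw [nuMoment, lintegral_fun_norm_addHaar volume
    (g := fun r => ENNReal.ofReal (r ^ ν * f (r ^ 2))) (by fun_prop), finrank_euclideanSpace_fin]
  congr 1
  rw [← lintegral_comp_rpow_Ioi
    (fun t => ENNReal.ofReal (t ^ (((n : ℝ) + ν) / 2 - 1) * f t)) (p := 2) (by norm_num),
    ← lintegral_const_mul' _ _ (by simp)]
  refine setLIntegral_congr_fun measurableSet_Ioi (fun x hx ↦ ?_)
  have hx : 0 < x := hx
  have h2 : (2⁻¹ : ℝ≥0∞) = ENNReal.ofReal 2⁻¹ := by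
    rw [ENNReal.ofReal_inv_of_pos two_pos]; simp
  rw [h2, ← ENNReal.ofReal_mul (by positivity), ← ENNReal.ofReal_mul (by positivity),
    ← ENNReal.ofReal_mul (by positivity), Real.rpow_two, ← Real.rpow_natCast x (n - 1),
    Nat.cast_sub hn, ← mul_assoc, ← Real.rpow_add hx]
  have h : (x ^ 2) ^ (((n : ℝ) + ν) / 2 - 1) = x ^ ((n : ℝ) + ν - 2) := by
    rw [← Real.rpow_natCast, ← Real.rpow_mul hx.le]
    congr 1
    push_cast
    ring
  have h' : x ^ ((n : ℝ) + ν - 2) * x = x ^ ((n : ℝ) - 1 + ν) := by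
    rw [← Real.rpow_add_one hx.ne']
    ring_nf
  have h1 : x ^ ((2:ℝ) - 1) = x := by norm_num
  rw [h, Nat.cast_one, ← h', abs_two, h1]
  congr 1
  ring

theorem lintegral_radial_density_ne_zero_ne_top {n : ℕ} (hn : 0 < n) {ν : ℝ} {f : ℝ → ℝ}
    (hf : Measurable f)
    (hdens : (∫⁻ x : EuclideanSpace ℝ (Fin n), ENNReal.ofReal (f (‖x‖ ^ 2))) = 1)
    (hmom : nuMoment n ν f < ⊤) :
    (∫⁻ t in Set.Ioi (0:ℝ), ENNReal.ofReal (t ^ (((n : ℝ) + ν) / 2 - 1) * f t)) ≠ 0 ∧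
    (∫⁻ t in Set.Ioi (0:ℝ), ENNReal.ofReal (t ^ (((n : ℝ) + ν) / 2 - 1) * f t)) ≠ ⊤ := by
  have : Nonempty (Fin n) := ⟨⟨0, hn⟩⟩
  have heq := nuMoment_eq hn (ν := ν) hf
  have hb : volume (Metric.ball (0 : EuclideanSpace ℝ (Fin n)) 1) ≠ 0 :=
    (Metric.measure_ball_pos _ _ one_pos).ne'
  constructor
  · intro h0
    rw [h0, mul_zero, mul_zero, nuMoment, lintegral_eq_zero_iff (by fun_prop)] at heq
    have hz : ∀ᵐ x : EuclideanSpace ℝ (Fin n), ENNReal.ofReal (f (‖x‖ ^ 2)) = 0 := by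
      filter_upwards [heq, Measure.ae_ne volume (0 : EuclideanSpace ℝ (Fin n))] with x hx hx0
      have hx0 : 0 < ‖x‖ := norm_pos_iff.2 hx0
      simp only [Pi.zero_apply, ENNReal.ofReal_eq_zero] at hx ⊢
      exact nonpos_of_mul_nonpos_right hx (by positivity)
    rw [lintegral_congr_ae hz] at hdens
    simp at hdens
  · intro h0
    rw [h0] at heq
    rw [heq, ENNReal.mul_top (by simp), ENNReal.mul_top (by simp [hb, hn.ne'])] at hmom
    exact lt_irrefl _ hmom

theorem lintegral_exp_neg_mul_sq {b : ℝ} (hb : 0 < b) :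
    ∫⁻ x : ℝ, ENNReal.ofReal (Real.exp (-(b * x ^ 2)))
      = ENNReal.ofReal ((Real.pi / b) ^ ((1:ℝ) / 2)) := by
  rw [← Real.sqrt_eq_rpow, ← integral_gaussian, ofReal_integral_eq_lintegral_ofReal]
  · simp
  · exact integrable_exp_neg_mul_sq hb
  · exact Filter.Eventually.of_forall fun x => by positivity

theorem lintegral_exp_neg_mul_sum_sq {ι : Type*} [Fintype ι] {b : ℝ} (hb : 0 < b) :
    ∫⁻ x : ι → ℝ, ENNReal.ofReal (Real.exp (-(b * ∑ i, x i ^ 2)))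
      = ENNReal.ofReal ((Real.pi / b) ^ ((Fintype.card ι : ℝ) / 2)) := by
  have h := GaussianFourier.integral_rexp_neg_mul_sq_norm (V := EuclideanSpace ℝ ι) hb
  rw [finrank_euclideanSpace] at h
  rw [← h, ofReal_integral_eq_lintegral_ofReal (.of_integral_ne_zero (by rw [h]; positivity))
      (Filter.Eventually.of_forall fun x => by positivity),
    ← (PiLp.volume_preserving_toLp ι).lintegral_comp (by fun_prop)]
  simp [EuclideanSpace.real_norm_sq_eq]

open scoped MatrixOrder in
theorem lintegral_exp_neg_mul_quadratic {ι : Type*} [Fintype ι] [DecidableEq ι]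
    {G : Matrix ι ι ℝ} (hG : G.PosDef) {b : ℝ} (hb : 0 < b) :
    ∫⁻ x : ι → ℝ, ENNReal.ofReal (Real.exp (-(b * (x ⬝ᵥ G *ᵥ x))))
      = ENNReal.ofReal ((Real.pi / b) ^ ((Fintype.card ι : ℝ) / 2)
          * G.det ^ (-(1:ℝ) / 2)) := by
  obtain ⟨S, hS⟩ : ∃ S : Matrix ι ι ℝ, G = Sᵀ * S := by
    obtain ⟨S, hS⟩ := CStarAlgebra.nonneg_iff_eq_star_mul_self.mp hG.posSemidef.nonneg
    exact ⟨S, by simpa [star_eq_conjTranspose] using hS⟩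
  have hdet : G.det = S.det ^ 2 := by rw [hS, det_mul, det_transpose, sq]
  have hSd : S.det ≠ 0 := by
    have := hG.det_pos
    rw [hdet] at this
    exact fun h => by simp [h] at this
  have hq : ∀ x : ι → ℝ, x ⬝ᵥ G *ᵥ x = ∑ i, (toLin' S x) i ^ 2 := by
    intro x
    rw [hS, ← mulVec_mulVec, dotProduct_mulVec, vecMul_transpose]
    simp [dotProduct, sq]
  simp_rw [hq]
  rw [← lintegral_map (μ := volume)
    (f := fun x : ι → ℝ => ENNReal.ofReal (Real.exp (-(b * ∑ i, x i ^ 2))))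
    (g := toLin' S) (by fun_prop) (LinearMap.continuous_of_finiteDimensional _).measurable,
    Real.map_matrix_volume_pi_eq_smul_volume_pi hSd, lintegral_smul_measure,
    lintegral_exp_neg_mul_sum_sq hb, smul_eq_mul, ← ENNReal.ofReal_mul (by positivity), mul_comm,
    hdet, ← sq_abs, ← Real.rpow_natCast, ← Real.rpow_mul (by positivity), abs_inv]
  norm_num [Real.rpow_neg_one]

theorem lintegral_lintegral_gaussian {ι : Type*} [Fintype ι] [DecidableEq ι]
    {G : Matrix ι ι ℝ} (hG : G.PosDef) {a b c : ℝ} (ha : 0 < a) (hb : 0 < b) (hc : 0 ≤ c)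
    (μ : ℝ) (m : ι → ℝ) :
    ∫⁻ α : ℝ, ∫⁻ β : ι → ℝ, ENNReal.ofReal (c * (Real.exp (-(a * (α - μ) ^ 2))
        * Real.exp (-(b * ((β - m) ⬝ᵥ G *ᵥ (β - m))))))
      = ENNReal.ofReal (c * ((Real.pi / a) ^ ((1:ℝ) / 2)
          * ((Real.pi / b) ^ ((Fintype.card ι : ℝ) / 2) * G.det ^ (-(1:ℝ) / 2)))) := by
  simp_rw [ENNReal.ofReal_mul hc, ENNReal.ofReal_mul (Real.exp_pos _).le]
  simp_rw [lintegral_const_mul' _ _ ENNReal.ofReal_ne_top]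
  rw [lintegral_sub_right_eq_self
      (fun β : ι → ℝ => ENNReal.ofReal (Real.exp (-(b * (β ⬝ᵥ G *ᵥ β))))) m,
    lintegral_exp_neg_mul_quadratic hG hb]
  rw [lintegral_mul_const' _ _ ENNReal.ofReal_ne_top,
    lintegral_sub_right_eq_self (fun α : ℝ => ENNReal.ofReal (Real.exp (-(a * α ^ 2)))) μ,
    lintegral_exp_neg_mul_sq ha, ← ENNReal.ofReal_mul (by positivity)]

theorem dotProduct_gram_mulVec {m ι : Type*} [Fintype m] [Fintype ι] (X : Matrix m ι ℝ)
    (u w : ι → ℝ) : u ⬝ᵥ (Xᵀ * X) *ᵥ w = ∑ i, (X *ᵥ u) i * (X *ᵥ w) i := by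
  rw [← mulVec_mulVec, dotProduct_mulVec, vecMul_transpose]
  rfl

theorem sum_mulVec_eq_zero {n : ℕ} {ι : Type*} [Fintype ι] {X : Matrix (Fin n) ι ℝ}
    (horth : Xᵀ *ᵥ (fun _ => 1) = 0) (β : ι → ℝ) :
    ∑ i, (X *ᵥ β) i = 0 := by
  have h : (fun _ => (1:ℝ)) ⬝ᵥ (X *ᵥ β) = 0 := by
    rw [dotProduct_mulVec, ← mulVec_transpose, horth, zero_dotProduct]
  simpa [dotProduct] using h

theorem gram_complete_square {n : ℕ} {ι : Type*} [Fintype ι] (X : Matrix (Fin n) ι ℝ) (β m : ι → ℝ)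
    {g : ℝ} (hg : 0 < g) :
    (β - m) ⬝ᵥ (Xᵀ * X) *ᵥ (β - m) + β ⬝ᵥ (Xᵀ * X) *ᵥ β / g
      = (1 + g) / g * ((β - (g / (1 + g)) • m) ⬝ᵥ (Xᵀ * X) *ᵥ (β - (g / (1 + g)) • m))
        + (∑ i, (X *ᵥ m) i ^ 2) / (1 + g) := by
  simp_rw [dotProduct_gram_mulVec, mulVec_sub, mulVec_smul, Finset.sum_div, Finset.mul_sum,
    ← Finset.sum_add_distrib]
  refine Finset.sum_congr rfl fun i _ => ?_
  simp only [Pi.sub_apply, Pi.smul_apply, smul_eq_mul]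
  field_simp
  ring

section LeastSquares

variable {n : ℕ} {ι : Type*} [Fintype ι] [DecidableEq ι] {X : Matrix (Fin n) ι ℝ} {v : Fin n → ℝ}

/-- The least squares estimator `(XᵀX)⁻¹Xᵀv`. -/
noncomputable def leastSquares (X : Matrix (Fin n) ι ℝ) (v : Fin n → ℝ) : ι → ℝ :=
  (Xᵀ * X)⁻¹ *ᵥ Xᵀ *ᵥ v

/-- The residual sum of squares of the least squares fit. -/
noncomputable def residualSumSq (X : Matrix (Fin n) ι ℝ) (v : Fin n → ℝ) : ℝ :=
  ∑ i, (v i - (X *ᵥ leastSquares X v) i) ^ 2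

theorem sum_residual_mul_mulVec (hG : (Xᵀ * X).PosDef) (β : ι → ℝ) :
    ∑ i, (v i - (X *ᵥ leastSquares X v) i) * (X *ᵥ β) i = 0 := by
  have h : (v - X *ᵥ leastSquares X v) ⬝ᵥ (X *ᵥ β) = 0 := by
    rw [dotProduct_mulVec, ← mulVec_transpose, mulVec_sub, mulVec_mulVec, leastSquares,
      mulVec_mulVec, mul_nonsing_inv _ hG.det_pos.ne'.isUnit, one_mulVec, sub_self,
      zero_dotProduct]
  simpa [dotProduct] using h

theorem sum_sq_add_sub_mulVec (hG : (Xᵀ * X).PosDef) (horth : Xᵀ *ᵥ (fun _ => 1) = 0)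
    (hv : ∑ i, v i = 0) (a : ℝ) (β : ι → ℝ) :
    ∑ i, (v i - a - (X *ᵥ β) i) ^ 2 = n * a ^ 2 + residualSumSq X v
      + (β - leastSquares X v) ⬝ᵥ (Xᵀ * X) *ᵥ (β - leastSquares X v) := by
  have h1 := sum_residual_mul_mulVec (v := v) hG (β - leastSquares X v)
  have h2 := sum_mulVec_eq_zero horth β
  have key : ∀ i, (v i - a - (X *ᵥ β) i) ^ 2 = a ^ 2 + (v i - (X *ᵥ leastSquares X v) i) ^ 2
      + (X *ᵥ (β - leastSquares X v)) i * (X *ᵥ (β - leastSquares X v)) i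
      - 2 * a * v i + 2 * a * (X *ᵥ β) i
      - 2 * ((v i - (X *ᵥ leastSquares X v) i) * (X *ᵥ (β - leastSquares X v)) i) := by
    intro i
    rw [mulVec_sub, Pi.sub_apply]
    ring
  rw [dotProduct_gram_mulVec, residualSumSq, Finset.sum_congr rfl fun i _ => key i]
  simp only [Finset.sum_sub_distrib, Finset.sum_add_distrib, ← Finset.mul_sum, h1, h2, hv]
  simp

theorem sum_sq_eq_residualSumSq_add (hG : (Xᵀ * X).PosDef) :
    ∑ i, v i ^ 2 = residualSumSq X v + ∑ i, (X *ᵥ leastSquares X v) i ^ 2 := by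
  have h1 := sum_residual_mul_mulVec (v := v) hG (leastSquares X v)
  have key : ∀ i, v i ^ 2 = (v i - (X *ᵥ leastSquares X v) i) ^ 2
      + (X *ᵥ leastSquares X v) i ^ 2
      + 2 * ((v i - (X *ᵥ leastSquares X v) i) * (X *ᵥ leastSquares X v) i) := fun i => by ring
  rw [Finset.sum_congr rfl fun i _ => key i, residualSumSq]
  simp_rw [Finset.sum_add_distrib, ← Finset.mul_sum, h1]
  simp

theorem residualSumSq_pos (hcol : ∀ β : ι → ℝ, v ≠ X *ᵥ β) : 0 < residualSumSq X v := by
  obtain ⟨i, hi⟩ := Function.ne_iff.1 (hcol (leastSquares X v))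
  exact Finset.sum_pos' (fun _ _ => sq_nonneg _)
    ⟨i, Finset.mem_univ _, sq_pos_of_ne_zero (sub_ne_zero.2 hi)⟩

end LeastSquares

theorem integrand_factor {n q ν η g A Q : ℝ} (hη : 0 < η) :
    η ^ ((n + ν) / 2 - 1) * Real.exp (-(A * η))
        * (g ^ (-((q - ν) / 2) - 1) * Real.exp (-((η * Q) / g)) * η ^ ((q - ν) / 2))
      = η ^ ((n + q) / 2 - 1) * g ^ (-((q - ν) / 2) - 1) * Real.exp (-(η * (A + Q / g))) := by
  have h : η ^ ((n + q) / 2 - 1) = η ^ ((n + ν) / 2 - 1) * η ^ ((q - ν) / 2) := by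
    rw [← Real.rpow_add hη]
    ring_nf
  have h' : Real.exp (-(η * (A + Q / g)))
      = Real.exp (-(A * η)) * Real.exp (-((η * Q) / g)) := by
    rw [← Real.exp_add]
    ring_nf
  rw [h, h']
  ring

/-- Powers of `A` and `Q` as a Gaussian scale mixture. -/
theorem ofReal_rpow_mul_rpow_eq_lintegral {n q ν A Q : ℝ} (hs : 0 < n + ν) (hq : ν < q)
    (hA : 0 < A) (hQ : 0 < Q) :
    ENNReal.ofReal (Real.Gamma ((n + ν) / 2) * Real.Gamma ((q - ν) / 2))
        * ENNReal.ofReal (A ^ (-((n + ν) / 2)) * Q ^ (-((q - ν) / 2)))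
      = ∫⁻ η in Set.Ioi (0:ℝ), ∫⁻ g in Set.Ioi (0:ℝ),
          ENNReal.ofReal (η ^ ((n + q) / 2 - 1) * g ^ (-((q - ν) / 2) - 1)
            * Real.exp (-(η * (A + Q / g)))) := by
  have ha : 0 < (q - ν) / 2 := by linarith
  have hG := Real.Gamma_pos_of_pos ha
  have hs' : 0 < (n + ν) / 2 := by linarith
  have hG' := Real.Gamma_pos_of_pos hs'
  have inner : ∀ η ∈ Set.Ioi (0:ℝ), ∫⁻ g in Set.Ioi (0:ℝ),
      ENNReal.ofReal (η ^ ((n + q) / 2 - 1) * g ^ (-((q - ν) / 2) - 1)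
            * Real.exp (-(η * (A + Q / g))))
      = ENNReal.ofReal (Q ^ (-((q - ν) / 2)) * Real.Gamma ((q - ν) / 2))
        * ENNReal.ofReal (η ^ ((n + ν) / 2 - 1) * Real.exp (-(A * η))) := by
    intro η hη
    have hη : 0 < η := hη
    calc
      _ = ∫⁻ g in Set.Ioi (0:ℝ), ENNReal.ofReal (η ^ ((n + ν) / 2 - 1) * Real.exp (-(A * η))
              * η ^ ((q - ν) / 2))
            * ENNReal.ofReal (g ^ (-((q - ν) / 2) - 1) * Real.exp (-((η * Q) / g))) := by
        refine setLIntegral_congr_fun measurableSet_Ioi fun g hg => ?_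
        rw [← integrand_factor hη, ← ENNReal.ofReal_mul (by positivity)]
        congr 1
        ring
      _ = _ := by
        rw [lintegral_const_mul' _ _ ENNReal.ofReal_ne_top,
          lintegral_rpow_mul_exp_neg_div_Ioi ha (by positivity),
          ← ENNReal.ofReal_mul (by positivity), ← ENNReal.ofReal_mul (by positivity),
          Real.mul_rpow hη.le hQ.le, Real.rpow_neg hη.le]
        congr 1
        have : η ^ ((q - ν) / 2) ≠ 0 := by positivity
        field_simp
  rw [setLIntegral_congr_fun measurableSet_Ioi inner,
    lintegral_const_mul' _ _ ENNReal.ofReal_ne_top, lintegral_rpow_mul_exp_neg_mul_Ioi hs' hA,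
    ← ENNReal.ofReal_mul (by positivity), ← ENNReal.ofReal_mul (by positivity)]
  congr 1
  ring

theorem lintegral_gaussian_model {n : ℕ} {ι : Type*} [Fintype ι] [DecidableEq ι]
    {X : Matrix (Fin n) ι ℝ} (hn : 1 < n) (hG : (Xᵀ * X).PosDef)
    (horth : Xᵀ *ᵥ (fun _ => 1) = 0)
    {y : Fin n → ℝ} {μ : ℝ} (hv : ∑ i, (y i - μ) = 0) {c η g : ℝ} (hη : 0 < η) (hg : 0 < g)
    (hc : 0 ≤ c) :
    ∫⁻ α : ℝ, ∫⁻ β : ι → ℝ, ENNReal.ofReal (c * Real.exp (-(η *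
        (∑ i, (y i - α - (X *ᵥ β) i) ^ 2 + β ⬝ᵥ (Xᵀ * X) *ᵥ β / g))))
      = ENNReal.ofReal (c * Real.exp (-((residualSumSq X (fun i => y i - μ)
            + (∑ i, (X *ᵥ leastSquares X (fun i => y i - μ)) i ^ 2) / (1 + g)) * η))
          * ((Real.pi / (η * n)) ^ ((1:ℝ) / 2)
            * ((Real.pi / (η * ((1 + g) / g))) ^ ((Fintype.card ι : ℝ) / 2)
              * (Xᵀ * X).det ^ (-(1:ℝ) / 2)))) := by
  have hn0 : (0:ℝ) < n := by exact_mod_cast (by omega : 0 < n)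
  rw [← lintegral_lintegral_gaussian hG (by positivity) (by positivity) (by positivity) μ
    ((g / (1 + g)) • leastSquares X (fun i => y i - μ))]
  refine lintegral_congr fun α => lintegral_congr fun β => ?_
  congr 1
  have h1 := sum_sq_add_sub_mulVec hG horth hv (α - μ) β
  have h2 := gram_complete_square X β (leastSquares X (fun i => y i - μ)) hg
  simp only [sub_sub_sub_cancel_right] at h1
  rw [h1, mul_assoc, ← Real.exp_add, ← Real.exp_add]
  congr 2
  linear_combination (-η) * h2

/-- Integrating the Gaussian `g`-prior model over the scale, the intercept and the regression
coefficients. -/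
theorem lintegral_mixture_model {n : ℕ} {ι : Type*} [Fintype ι] [DecidableEq ι]
    {X : Matrix (Fin n) ι ℝ} (hn : 1 < n) (hG : (Xᵀ * X).PosDef)
    (horth : Xᵀ *ᵥ (fun _ => 1) = 0) {y : Fin n → ℝ} {μ : ℝ} (hv : ∑ i, (y i - μ) = 0)
    (hcol : ∀ β : ι → ℝ, (fun i => y i - μ) ≠ X *ᵥ β) {ν g : ℝ} (hg : 0 < g) :
    ∫⁻ η in Set.Ioi (0:ℝ), ∫⁻ α : ℝ, ∫⁻ β : ι → ℝ,
        ENNReal.ofReal (η ^ (((n : ℝ) + Fintype.card ι) / 2 - 1)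
          * g ^ (-(((Fintype.card ι : ℝ) - ν) / 2) - 1) * Real.exp (-(η *
            (∑ i, (y i - α - (X *ᵥ β) i) ^ 2 + β ⬝ᵥ (Xᵀ * X) *ᵥ β / g))))
      = ENNReal.ofReal ((Real.pi / n) ^ ((1:ℝ) / 2) * Real.pi ^ ((Fintype.card ι : ℝ) / 2)
            * (Xᵀ * X).det ^ (-(1:ℝ) / 2) * Real.Gamma (((n : ℝ) - 1) / 2)
            * (∑ i, (y i - μ) ^ 2) ^ (-((n : ℝ) - 1) / 2))
        * ENNReal.ofReal (g ^ (ν / 2 - 1) * (1 + g) ^ (((n : ℝ) - Fintype.card ι - 1) / 2)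
          * (g * (1 - (∑ i, (X *ᵥ leastSquares X (fun i => y i - μ)) i ^ 2)
              / ∑ i, (y i - μ) ^ 2) + 1) ^ (-((n : ℝ) - 1) / 2)) := by
  set q : ℝ := (Fintype.card ι : ℝ) with hq
  set P := ∑ i, (X *ᵥ leastSquares X (fun i => y i - μ)) i ^ 2 with hP
  set E := residualSumSq X (fun i => y i - μ) with hE
  have hVEP : ∑ i, (y i - μ) ^ 2 = E + P :=
    sum_sq_eq_residualSumSq_add (v := fun i => y i - μ) hG
  have hE0 : 0 < E := residualSumSq_pos hcol
  have hP0 : 0 ≤ P := by positivity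
  have hn0 : (0:ℝ) < n := by exact_mod_cast (by omega : 0 < n)
  have hn1 : (1:ℝ) < n := by exact_mod_cast hn
  have hk : 0 < ((n : ℝ) - 1) / 2 := by linarith
  have hΓ := Real.Gamma_pos_of_pos hk
  have hdet := hG.det_pos
  have hD : 0 < E + P / (1 + g) := by positivity
  rw [hVEP]
  calc
    _ = ∫⁻ η in Set.Ioi (0:ℝ), ENNReal.ofReal ((Real.pi / n) ^ ((1:ℝ) / 2)
          * Real.pi ^ (q / 2) * (Xᵀ * X).det ^ (-(1:ℝ) / 2)
          * (g ^ (ν / 2 - 1) * (1 + g) ^ (-(q / 2))))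
          * ENNReal.ofReal (η ^ (((n : ℝ) - 1) / 2 - 1)
            * Real.exp (-((E + P / (1 + g)) * η))) := by
      refine setLIntegral_congr_fun measurableSet_Ioi fun η hη => ?_
      have hη : 0 < η := hη
      rw [lintegral_gaussian_model hn hG horth hv hη hg (by positivity), ← hE, ← hP, ← hq,
        ← ENNReal.ofReal_mul (by positivity)]
      congr 1
      generalize Real.exp (-((E + P / (1 + g)) * η)) = z
      have e1 : η ^ ((n + q) / 2 - 1)
          = η ^ (((n : ℝ) - 1) / 2 - 1) * η ^ ((1:ℝ) / 2) * η ^ (q / 2) := by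
        rw [← Real.rpow_add hη, ← Real.rpow_add hη]
        ring_nf
      have e2 : g ^ (-((q - ν) / 2) - 1) = g ^ (ν / 2 - 1) / g ^ (q / 2) := by
        rw [← Real.rpow_sub hg]
        ring_nf
      have e3 : (Real.pi / (η * n)) ^ ((1:ℝ) / 2)
          = (Real.pi / n) ^ ((1:ℝ) / 2) / η ^ ((1:ℝ) / 2) := by
        rw [← Real.div_rpow (by positivity) hη.le, div_div, mul_comm η]
      have e4 : (Real.pi / (η * ((1 + g) / g))) ^ (q / 2)
          = Real.pi ^ (q / 2) * g ^ (q / 2) * (1 + g) ^ (-(q / 2)) / η ^ (q / 2) := by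
        rw [Real.rpow_neg (by positivity), Real.div_rpow (by positivity) (by positivity),
          Real.mul_rpow (by positivity) (by positivity),
          Real.div_rpow (by positivity) (by positivity)]
        have : g ^ (q / 2) ≠ 0 := by positivity
        field_simp
      rw [e1, e2, e3, e4]
      have : g ^ (q / 2) ≠ 0 := by positivity
      have : η ^ (q / 2) ≠ 0 := by positivity
      have : η ^ ((1:ℝ) / 2) ≠ 0 := by positivity
      field_simp
    _ = _ := by
      rw [lintegral_const_mul' _ _ ENNReal.ofReal_ne_top,
        lintegral_rpow_mul_exp_neg_mul_Ioi hk hD, ← ENNReal.ofReal_mul (by positivity),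
        ← ENNReal.ofReal_mul (by positivity)]
      congr 1
      have e1 : (E + P / (1 + g)) ^ (-(((n : ℝ) - 1) / 2))
          = (E + P) ^ (-((n : ℝ) - 1) / 2) * (g * (1 - P / (E + P)) + 1) ^ (-((n : ℝ) - 1) / 2)
            * (1 + g) ^ (((n : ℝ) - 1) / 2) := by
        have h : E + P / (1 + g) = (E + P) * (g * (1 - P / (E + P)) + 1) * (1 + g)⁻¹ := by
          field_simp
          ring
        have h0 : 0 < g * (1 - P / (E + P)) + 1 := by
          have : 1 - P / (E + P) = E / (E + P) := by field_simp; ring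
          rw [this]
          positivity
        rw [h, Real.mul_rpow (by positivity) (by positivity), Real.inv_rpow (by positivity),
          ← Real.rpow_neg (by positivity), neg_neg, Real.mul_rpow (by positivity) h0.le, neg_div]
      have e2 : (1 + g) ^ (((n : ℝ) - q - 1) / 2)
          = (1 + g) ^ (-(q / 2)) * (1 + g) ^ (((n : ℝ) - 1) / 2) := by
        rw [← Real.rpow_add (by positivity)]
        ring_nf
      rw [e1, e2]
      ring

/-- The marginal density factors as a constant not depending on the design, a radial moment of
`f`, and a `g`-integral not depending on `f`. -/
theorem subharmonicMarginal_eq {n : ℕ} {ι : Type} [Fintype ι] [DecidableEq ι]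
    {X : Matrix (Fin n) ι ℝ} (hn : 1 < n) (hX : Function.Injective X.mulVec)
    (horth : Xᵀ *ᵥ (fun _ => 1) = 0) {y : Fin n → ℝ}
    (hcol : ∀ β : ι → ℝ, (fun i => y i - (∑ j, y j) / n) ≠ X *ᵥ β)
    {f : ℝ → ℝ} {ν : ℝ} (hν : 0 < ν) (hνq : ν < Fintype.card ι)
    (hK : (∫⁻ t in Set.Ioi (0:ℝ), ENNReal.ofReal (t ^ (((n : ℝ) + ν) / 2 - 1) * f t)) ≠ ⊤) :
    subharmonicMarginal n X y ν f
      = ENNReal.ofReal ((Real.pi / n) ^ ((1:ℝ) / 2) * Real.Gamma (((n : ℝ) - 1) / 2)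
            / (2 ^ (ν / 2) * Real.Gamma (((n : ℝ) + ν) / 2))
            * (∑ i, (y i - (∑ j, y j) / n) ^ 2) ^ (-((n : ℝ) - 1) / 2))
        * (∫⁻ t in Set.Ioi (0:ℝ), ENNReal.ofReal (t ^ (((n : ℝ) + ν) / 2 - 1) * f t))
        * ∫⁻ g in Set.Ioi (0:ℝ),
            ENNReal.ofReal (g ^ (ν / 2 - 1) * (1 + g) ^ (((n : ℝ) - Fintype.card ι - 1) / 2)
              * (g * (1 - coeffDet n X y) + 1) ^ (-((n : ℝ) - 1) / 2)) := by
  have hn0 : (0:ℝ) < n := by exact_mod_cast (by omega : 0 < n)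
  have hn1 : (1:ℝ) < n := by exact_mod_cast hn
  have : Nonempty ι := by
    rw [← Fintype.card_pos_iff]
    exact_mod_cast hν.trans hνq
  have hG : (Xᵀ * X).PosDef := by
    simpa [conjTranspose_eq_transpose_of_trivial] using PosDef.conjTranspose_mul_self X hX
  have hdet := hG.det_pos
  have hv : ∑ i, (y i - (∑ j, y j) / n) = 0 := by
    rw [Finset.sum_sub_distrib]
    simp
    field_simp
    simp
  set μ := (∑ j, y j) / n with hμ
  set K := ∫⁻ t in Set.Ioi (0:ℝ), ENNReal.ofReal (t ^ (((n : ℝ) + ν) / 2 - 1) * f t) with hKdef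
  have hR : coeffDet n X y = (∑ i, (X *ᵥ leastSquares X (fun i => y i - μ)) i ^ 2)
      / ∑ i, (y i - μ) ^ 2 := rfl
  set q : ℝ := (Fintype.card ι : ℝ) with hq
  have hΓa : 0 < Real.Gamma ((q - ν) / 2) := Real.Gamma_pos_of_pos (by linarith)
  have hΓs : 0 < Real.Gamma (((n : ℝ) + ν) / 2) := Real.Gamma_pos_of_pos (by linarith)
  have hΓk : 0 < Real.Gamma (((n : ℝ) - 1) / 2) := Real.Gamma_pos_of_pos (by linarith)
  have hQ : ∀ β : ι → ℝ, 0 ≤ β ⬝ᵥ (Xᵀ * X) *ᵥ β := fun β => by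
    simpa using hG.posSemidef.dotProduct_mulVec_nonneg β
  have hA : ∀ (α : ℝ) (β : ι → ℝ), 0 < ∑ i, (y i - α - (X *ᵥ β) i) ^ 2 := by
    intro α β
    have h := sum_sq_add_sub_mulVec hG horth hv (α - μ) β
    simp only [sub_sub_sub_cancel_right] at h
    have := residualSumSq_pos hcol
    have := hQ (β - leastSquares X fun i => y i - μ)
    rw [h]
    positivity
  have hV : 0 < ∑ i, (y i - μ) ^ 2 := by simpa using hA μ 0
  set c := Real.Gamma ((q - ν) / 2) / (2 ^ (ν / 2) * Real.pi ^ (q / 2)) with hc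
  have hc0 : 0 < c := by positivity
  calc
    subharmonicMarginal n X y ν f
      = ∫⁻ α : ℝ, ∫⁻ β : ι → ℝ, (ENNReal.ofReal (c * (Xᵀ * X).det ^ ((1:ℝ) / 2)
            / (Real.Gamma (((n : ℝ) + ν) / 2) * Real.Gamma ((q - ν) / 2))) * K)
          * ∫⁻ η in Set.Ioi (0:ℝ), ∫⁻ g in Set.Ioi (0:ℝ),
            ENNReal.ofReal (η ^ ((n + q) / 2 - 1) * g ^ (-((q - ν) / 2) - 1)
              * Real.exp (-(η * (∑ i, (y i - α - (X *ᵥ β) i) ^ 2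
                + β ⬝ᵥ (Xᵀ * X) *ᵥ β / g)))) := by
      rw [subharmonicMarginal]
      refine lintegral_congr fun α => lintegral_congr_ae ?_
      filter_upwards [Measure.ae_ne volume (0 : ι → ℝ)] with β hβ
      have hQβ : 0 < β ⬝ᵥ (Xᵀ * X) *ᵥ β := by
        simpa using hG.dotProduct_mulVec_pos hβ
      rw [← ofReal_rpow_mul_rpow_eq_lintegral (by linarith) hνq (hA α β) hQβ]
      calc
        _ = ∫⁻ η in Set.Ioi (0:ℝ), ENNReal.ofReal (c * (Xᵀ * X).det ^ ((1:ℝ) / 2)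
              * (β ⬝ᵥ (Xᵀ * X) *ᵥ β) ^ (-((q - ν) / 2)))
            * ENNReal.ofReal (η ^ (((n : ℝ) + ν) / 2 - 1)
              * f (η * ∑ i, (y i - α - (X *ᵥ β) i) ^ 2)) := by
          refine setLIntegral_congr_fun measurableSet_Ioi fun η hη => ?_
          have hη : 0 < η := hη
          have h : η ^ (((n : ℝ) + ν) / 2 - 1) = η ^ ((n : ℝ) / 2) * η ^ (ν / 2 - 1) := by
            rw [← Real.rpow_add hη]
            ring_nf
          rw [← ENNReal.ofReal_mul (by positivity), h, neg_div]
          congr 1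
          ring
        _ = _ := by
          rw [lintegral_const_mul' _ _ ENNReal.ofReal_ne_top,
            lintegral_rpow_mul_comp_mul_Ioi f _ (hA α β), ← hKdef, ← mul_assoc, mul_right_comm _ K,
            ← ENNReal.ofReal_mul (by positivity), ← ENNReal.ofReal_mul (by positivity),
            ← ENNReal.ofReal_mul (by positivity)]
          congr 2
          field_simp
    _ = (ENNReal.ofReal (c * (Xᵀ * X).det ^ ((1:ℝ) / 2)
            / (Real.Gamma (((n : ℝ) + ν) / 2) * Real.Gamma ((q - ν) / 2))) * K)
          * ∫⁻ g in Set.Ioi (0:ℝ), ∫⁻ η in Set.Ioi (0:ℝ), ∫⁻ α : ℝ, ∫⁻ β : ι → ℝ,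
            ENNReal.ofReal (η ^ ((n + q) / 2 - 1) * g ^ (-((q - ν) / 2) - 1)
              * Real.exp (-(η * (∑ i, (y i - α - (X *ᵥ β) i) ^ 2
                + β ⬝ᵥ (Xᵀ * X) *ᵥ β / g)))) := by
      simp_rw [lintegral_const_mul' _ _ (ENNReal.mul_ne_top ENNReal.ofReal_ne_top hK)]
      rw [lintegral_lintegral_lintegral_lintegral_swap]
      simp only [mulVec, dotProduct]
      fun_prop
    _ = _ := by
      rw [setLIntegral_congr_fun measurableSet_Ioi
          fun g hg => lintegral_mixture_model (ν := ν) hn hG horth hv hcol hg,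
        lintegral_const_mul' _ _ ENNReal.ofReal_ne_top, hR, ← mul_assoc, mul_right_comm _ K,
        ← ENNReal.ofReal_mul (by positivity)]
      congr 3
      have h : (Xᵀ * X).det ^ (-(1:ℝ) / 2) = ((Xᵀ * X).det ^ ((1:ℝ) / 2))⁻¹ := by
        rw [← Real.rpow_neg hdet.le, neg_div]
      have h' : (Xᵀ * X).det ^ ((1:ℝ) / 2) ≠ 0 := by positivity
      rw [h, hc, ← hq]
      field_simp

/-- **Theorem 1, distributional robustness of the Bayes factor.**
The Bayes factor of a non-null submodel against the full model, under the sub-harmonic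
priors, does not depend on the spherically symmetric error density `f` and is given by
the displayed ratio of `g`-integrals. -/
theorem bayesFactor_subharmonic_robust
    (n p : ℕ) (hn : p + 1 < n)
    (XF : Matrix (Fin n) (Fin p) ℝ) (hrank : XF.rank = p)
    (horth : XFᵀ.mulVec (fun _ => 1) = 0)
    (γ : Finset (Fin p)) (hγ : γ.Nonempty)
    (y : Fin n → ℝ)
    (hy : (fun i => y i - (∑ j, y j) / n) ≠ 0)
    (hcol : ∀ β : Fin p → ℝ, (fun i => y i - (∑ j, y j) / n) ≠ XF.mulVec β)
    (f : ℝ → ℝ) (hmeas : Measurable f) (hpos : ∀ t, 0 ≤ f t)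
    (hdens : (∫⁻ x : EuclideanSpace ℝ (Fin n), ENNReal.ofReal (f (‖x‖ ^ 2))) = 1)
    (ν : ℝ) (hν0 : 0 < ν) (hνq : ν < γ.card)
    (hmom : nuMoment n ν f < ⊤) :
    subharmonicMarginal n (Matrix.of fun i (j : {j // j ∈ γ}) => XF i (j : Fin p)) y ν f
        / subharmonicMarginal n XF y ν f
      = (∫⁻ g in Set.Ioi (0:ℝ),
            ENNReal.ofReal (g ^ (ν / 2 - 1) * (1 + g) ^ (((n : ℝ) - γ.card - 1) / 2)
              * (g * (1 - coeffDet n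
                    (Matrix.of fun i (j : {j // j ∈ γ}) => XF i (j : Fin p)) y) + 1)
                  ^ (-((n : ℝ) - 1) / 2)))
        / (∫⁻ g in Set.Ioi (0:ℝ),
            ENNReal.ofReal (g ^ (ν / 2 - 1) * (1 + g) ^ (((n : ℝ) - p - 1) / 2)
              * (g * (1 - coeffDet n XF y) + 1) ^ (-((n : ℝ) - 1) / 2))) := by

  have hn0 : 0 < n := by omega
  have hn1 : (1:ℝ) < n := by exact_mod_cast (by omega : 1 < n)
  obtain ⟨hK0, hK⟩ := lintegral_radial_density_ne_zero_ne_top hn0 hmeas hdens hmom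
  have hinj : Function.Injective XF.mulVec := by
    have h : Function.Injective (XF.mulVecLin) := by
      rw [← LinearMap.ker_eq_bot, ← Submodule.finrank_eq_zero]
      have := XF.mulVecLin.finrank_range_add_finrank_ker
      have hr : Module.finrank ℝ (LinearMap.range XF.mulVecLin) = p := hrank
      simp only [hr, Module.finrank_fin_fun] at this
      omega
    exact h
  set Xγ : Matrix (Fin n) {j // j ∈ γ} ℝ :=
    Matrix.of fun i (j : {j // j ∈ γ}) => XF i (j : Fin p) with hXγ
  have hext : ∀ β : {j // j ∈ γ} → ℝ,
      Xγ *ᵥ β = XF *ᵥ (fun j => if h : j ∈ γ then β ⟨j, h⟩ else 0) := by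
    intro β
    ext i
    simp only [mulVec, dotProduct]
    rw [← Finset.sum_subset (Finset.subset_univ γ) fun j _ hj => by simp [hj],
      ← Finset.sum_coe_sort γ]
    simp [hXγ]
  have hinjγ : Function.Injective Xγ.mulVec := by
    intro β β' h
    rw [hext, hext] at h
    have h := hinj h
    ext ⟨j, hj⟩
    simpa [hj] using congrFun h j
  have horthγ : Xγᵀ *ᵥ (fun _ => 1) = 0 := by
    ext j
    exact congrFun horth j
  have hcolγ : ∀ β : {j // j ∈ γ} → ℝ,
      (fun i => y i - (∑ j, y j) / n) ≠ Xγ *ᵥ β := fun β => by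
    rw [hext]
    exact hcol _
  have hcard : γ.card ≤ p := by simpa using Finset.card_le_univ γ
  have hνp : ν < p := hνq.trans_le (by exact_mod_cast hcard)
  have hγ' := subharmonicMarginal_eq (by omega) hinjγ horthγ hcolγ hν0 (by simpa using hνq) hK
  have hF := subharmonicMarginal_eq (by omega) hinj horth hcol hν0 (by simpa using hνp) hK
  rw [Fintype.card_coe] at hγ'
  rw [Fintype.card_fin] at hF
  have hV : 0 < ∑ i, (y i - (∑ j, y j) / n) ^ 2 := by
    obtain ⟨i, hi⟩ := Function.ne_iff.1 hy
    exact Finset.sum_pos' (fun _ _ => sq_nonneg _) ⟨i, Finset.mem_univ _, sq_pos_of_ne_zero hi⟩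
  have hΓs : 0 < Real.Gamma (((n : ℝ) + ν) / 2) := Real.Gamma_pos_of_pos (by linarith)
  have hΓk : 0 < Real.Gamma (((n : ℝ) - 1) / 2) := Real.Gamma_pos_of_pos (by linarith)
  rw [hγ', hF]
  refine ENNReal.mul_div_mul_left _ _ (mul_ne_zero ?_ hK0)
    (ENNReal.mul_ne_top ENNReal.ofReal_ne_top hK)
  rw [← pos_iff_ne_zero, ENNReal.ofReal_pos]
  positivity
end

section
/- (Lemma 3, part 2.) Under the consistency setup, let γ ⊆ {1,…,p} with γ ⊋ T. Then: (i) deterministically, on the event where R_T² and R_γ² are defined, (1 − R_T²)/(1 − R_γ²) ≥ 1 (equivalently R_γ² ≥ R_T², since the column space of X_T^{(n)} is contained in that of X_γ^{(n)}); and (ii) for every k with 0 < k < 1 there exists a constant C > 0, not depending on n, such that for all sufficiently large n, 𝒫( 1 ≤ ((1 − R_T²)/(1 − R_γ²))^n < 1 + C ) > 1 − k. -/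
open MeasureTheory Matrix Filter ENNReal

/-- The submatrix of `X` consisting of the columns indexed by `γ`. -/
noncomputable def designSub {n p : ℕ} (X : Matrix (Fin n) (Fin p) ℝ)
    (γ : Finset (Fin p)) : Matrix (Fin n) {j // j ∈ γ} ℝ :=
  Matrix.of fun i j => X i (j : Fin p)

/-- The residual projector `Q_γ = I - X_γ(X_γᵀX_γ)⁻¹X_γᵀ` of the submodel `γ`. -/
noncomputable def residProj {n p : ℕ} (X : Matrix (Fin n) (Fin p) ℝ)
    (γ : Finset (Fin p)) : Matrix (Fin n) (Fin n) ℝ :=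
  1 - designSub X γ * ((designSub X γ)ᵀ * designSub X γ)⁻¹ * (designSub X γ)ᵀ

/-- The coefficient of determination
`R_γ² = 1 - ‖Q_γ(y-ȳ1)‖²/‖y-ȳ1‖²` of the submodel `γ`. -/
noncomputable def RsqC {n p : ℕ} (X : Matrix (Fin n) (Fin p) ℝ) (γ : Finset (Fin p))
    (y : Fin n → ℝ) : ℝ :=
  1 - (∑ i, ((residProj X γ).mulVec (fun j => y j - (∑ l, y l) / n) i) ^ 2)
      / (∑ i, (y i - (∑ l, y l) / n) ^ 2)

/-- The response `y = α_T 1 + X β_T + σ_T ε` of the true model. -/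
noncomputable def yResp {n p : ℕ} (X : Matrix (Fin n) (Fin p) ℝ) (αT : ℝ)
    (βT : Fin p → ℝ) (σT : ℝ) (ε : Fin n → ℝ) : Fin n → ℝ :=
  fun i => αT + X.mulVec βT i + σT * ε i

/-- The hat matrix `A(AᵀA)⁻¹Aᵀ` of a design matrix `A`. -/
noncomputable def hatMatrix {m κ : Type*} [Fintype m] [Fintype κ] [DecidableEq κ]
    (A : Matrix m κ ℝ) : Matrix m m ℝ :=
  A * (Aᵀ * A)⁻¹ * Aᵀ

section HatMatrix

variable {m κ : Type*} [Fintype m] [Fintype κ] [DecidableEq κ] {A : Matrix m κ ℝ}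

lemma hatMatrix_transpose (A : Matrix m κ ℝ) : (hatMatrix A)ᵀ = hatMatrix A := by
  simp [hatMatrix, Matrix.transpose_mul, Matrix.transpose_nonsing_inv, Matrix.mul_assoc]

lemma hatMatrix_mul_self (hA : IsUnit (Aᵀ * A).det) : hatMatrix A * A = A := by
  rw [hatMatrix, Matrix.mul_assoc, Matrix.mul_assoc, Matrix.nonsing_inv_mul _ hA, Matrix.mul_one]

lemma hatMatrix_idem (hA : IsUnit (Aᵀ * A).det) : hatMatrix A * hatMatrix A = hatMatrix A := by
  have h := congrArg (fun B => B * (Aᵀ * A)⁻¹ * Aᵀ) (hatMatrix_mul_self hA)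
  simpa only [hatMatrix, Matrix.mul_assoc] using h

lemma trace_hatMatrix (hA : IsUnit (Aᵀ * A).det) :
    (hatMatrix A).trace = Fintype.card κ := by
  rw [hatMatrix, Matrix.trace_mul_comm, ← Matrix.mul_assoc, Matrix.mul_nonsing_inv _ hA,
    Matrix.trace_one]

lemma sum_sq_hatMatrix (hA : IsUnit (Aᵀ * A).det) :
    ∑ i, ∑ j, hatMatrix A i j ^ 2 = Fintype.card κ := by
  rw [← trace_hatMatrix hA]
  conv_rhs => rw [← hatMatrix_idem hA]
  simp only [Matrix.trace, Matrix.diag, Matrix.mul_apply]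
  refine Finset.sum_congr rfl fun i _ => Finset.sum_congr rfl fun j _ => ?_
  have h := congrFun (congrFun (hatMatrix_transpose A) j) i
  rw [Matrix.transpose_apply] at h
  rw [← h, sq]

lemma sum_sq_sub_hatMatrix_mulVec (hA : IsUnit (Aᵀ * A).det) (v : m → ℝ) :
    ∑ i, (v i - (hatMatrix A *ᵥ v) i) ^ 2 = ∑ i, v i ^ 2 - ∑ i, (hatMatrix A *ᵥ v) i ^ 2 := by
  have h : (hatMatrix A *ᵥ v) ⬝ᵥ (hatMatrix A *ᵥ v) = v ⬝ᵥ (hatMatrix A *ᵥ v) := by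
    rw [Matrix.dotProduct_mulVec, ← Matrix.mulVec_transpose, hatMatrix_transpose,
      Matrix.mulVec_mulVec, hatMatrix_idem hA, dotProduct_comm]
  simp only [dotProduct, ← sq] at h
  have e : ∀ i, (v i - (hatMatrix A *ᵥ v) i) ^ 2
      = v i ^ 2 - 2 * (v i * (hatMatrix A *ᵥ v) i) + (hatMatrix A *ᵥ v) i ^ 2 := fun i => by ring
  simp only [e, Finset.sum_add_distrib, Finset.sum_sub_distrib, ← Finset.mul_sum, ← h]
  ring

end HatMatrix

section Resid

variable {n p : ℕ} {X : Matrix (Fin n) (Fin p) ℝ} {T γ : Finset (Fin p)}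

lemma residProj_eq (X : Matrix (Fin n) (Fin p) ℝ) (γ : Finset (Fin p)) :
    residProj X γ = 1 - hatMatrix (designSub X γ) := rfl

lemma sum_sq_residProj_mulVec (hγ : IsUnit ((designSub X γ)ᵀ * designSub X γ).det)
    (v : Fin n → ℝ) :
    ∑ i, (residProj X γ *ᵥ v) i ^ 2
      = ∑ i, v i ^ 2 - ∑ i, (hatMatrix (designSub X γ) *ᵥ v) i ^ 2 := by
  rw [← sum_sq_sub_hatMatrix_mulVec hγ, residProj_eq]
  simp [Matrix.sub_mulVec]

lemma residProj_mul_designSub (hTγ : T ⊆ γ)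
    (hγ : IsUnit ((designSub X γ)ᵀ * designSub X γ).det) :
    residProj X γ * designSub X T = 0 := by
  rw [residProj_eq, Matrix.sub_mul, Matrix.one_mul, sub_eq_zero]
  ext i j
  exact (congrFun (congrFun (hatMatrix_mul_self hγ) i) ⟨j, hTγ j.2⟩).symm

lemma sum_sq_residProj_mulVec_anti (hTγ : T ⊆ γ)
    (hγ : IsUnit ((designSub X γ)ᵀ * designSub X γ).det) (v : Fin n → ℝ) :
    ∑ i, (residProj X γ *ᵥ v) i ^ 2 ≤ ∑ i, (residProj X T *ᵥ v) i ^ 2 := by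
  have h : residProj X γ * residProj X T = residProj X γ := by
    conv_lhs => rw [residProj_eq X T, Matrix.mul_sub, Matrix.mul_one, hatMatrix,
      ← Matrix.mul_assoc, ← Matrix.mul_assoc, residProj_mul_designSub hTγ hγ]
    simp
  rw [← h, ← Matrix.mulVec_mulVec, sum_sq_residProj_mulVec hγ]
  exact sub_le_self _ (Finset.sum_nonneg fun i _ => sq_nonneg _)

lemma residProj_mulVec_yResp (hn : n ≠ 0) (horth : ∀ j, ∑ i, X i j = 0) (hTγ : T ⊆ γ)
    (hγ : IsUnit ((designSub X γ)ᵀ * designSub X γ).det) (α σ : ℝ) {β : Fin p → ℝ}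
    (hβ : ∀ j ∉ T, β j = 0) (e : Fin n → ℝ) :
    residProj X γ *ᵥ (fun j => yResp X α β σ e j - (∑ l, yResp X α β σ e l) / n)
      = σ • (residProj X γ *ᵥ fun j => e j - (∑ l, e l) / n) := by
  have hX : X *ᵥ β = designSub X T *ᵥ fun j => β j := by
    ext i
    simp only [Matrix.mulVec, dotProduct, designSub, Matrix.of_apply]
    rw [Finset.sum_coe_sort T (fun j => X i j * β j)]
    exact (Finset.sum_subset (Finset.subset_univ T) fun j _ hj => by simp [hβ j hj]).symm
  have hsum : ∑ i, (X *ᵥ β) i = 0 := by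
    simp only [Matrix.mulVec, dotProduct]
    rw [Finset.sum_comm]
    simp [← Finset.sum_mul, horth]
  have hn' : (n : ℝ) ≠ 0 := by exact_mod_cast hn
  have hv : (fun j => yResp X α β σ e j - (∑ l, yResp X α β σ e l) / n)
      = designSub X T *ᵥ (fun j => β j) + σ • fun j => e j - (∑ l, e l) / n := by
    ext j
    simp only [yResp, Finset.sum_add_distrib, ← Finset.mul_sum, hsum, Pi.add_apply, Pi.smul_apply,
      smul_eq_mul, ← hX, Finset.sum_const, Finset.card_univ, Fintype.card_fin, nsmul_eq_mul]
    field_simp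
    ring
  rw [hv, Matrix.mulVec_add, Matrix.mulVec_mulVec, residProj_mul_designSub hTγ hγ,
    Matrix.zero_mulVec, zero_add, Matrix.mulVec_smul]

lemma hatMatrix_mulVec_sub_const (horth : ∀ j, ∑ i, X i j = 0) (e : Fin n → ℝ) (c : ℝ) :
    hatMatrix (designSub X γ) *ᵥ (fun j => e j - c) = hatMatrix (designSub X γ) *ᵥ e := by
  have h : (designSub X γ)ᵀ *ᵥ (fun _ => c) = 0 := by
    ext j
    simp [Matrix.mulVec, dotProduct, designSub, ← Finset.sum_mul, horth]
  have e' : (fun j => e j - c) = e - fun _ => c := rfl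
  rw [e', Matrix.mulVec_sub, hatMatrix, ← Matrix.mulVec_mulVec (fun _ => c), h, Matrix.mulVec_zero,
    sub_zero]

lemma sum_sq_sub_mean (hn : n ≠ 0) (e : Fin n → ℝ) :
    ∑ i, (e i - (∑ l, e l) / n) ^ 2 = ∑ i, e i ^ 2 - (∑ l, e l) ^ 2 / n := by
  have hn' : (n : ℝ) ≠ 0 := by exact_mod_cast hn
  have h : ∀ i, (e i - (∑ l, e l) / n) ^ 2
      = e i ^ 2 - 2 * ((∑ l, e l) / n) * e i + ((∑ l, e l) / n) ^ 2 := fun i => by ring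
  simp only [h, Finset.sum_add_distrib, Finset.sum_sub_distrib, ← Finset.mul_sum,
    Finset.sum_const, Finset.card_univ, Fintype.card_fin, nsmul_eq_mul]
  field_simp
  ring

lemma RsqC_mono (hTγ : T ⊆ γ) (hγ : IsUnit ((designSub X γ)ᵀ * designSub X γ).det)
    (y : Fin n → ℝ) : RsqC X T y ≤ RsqC X γ y := by
  unfold RsqC
  refine sub_le_sub_left (div_le_div_of_nonneg_right (sum_sq_residProj_mulVec_anti hTγ hγ _) ?_) _
  exact Finset.sum_nonneg fun i _ => sq_nonneg _

/-- The ratio of residual sums of squares is controlled by the part of the noise lying in the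
column space of `(1, X_γ)`. -/
lemma RsqC_ratio_bounds (hn : n ≠ 0) (horth : ∀ j, ∑ i, X i j = 0) (hTγ : T ⊆ γ)
    (hT : IsUnit ((designSub X T)ᵀ * designSub X T).det)
    (hγ : IsUnit ((designSub X γ)ᵀ * designSub X γ).det) (α : ℝ) {σ : ℝ} (hσ : 0 < σ)
    {β : Fin p → ℝ} (hβ : ∀ j ∉ T, β j = 0) (e : Fin n → ℝ) {B D : ℝ} (hD : 0 < D)
    (hB : (∑ l, e l) ^ 2 / n + ∑ i, (hatMatrix (designSub X γ) *ᵥ e) i ^ 2 ≤ B)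
    (hBD : B + D ≤ ∑ i, e i ^ 2) :
    1 ≤ (1 - RsqC X T (yResp X α β σ e)) / (1 - RsqC X γ (yResp X α β σ e)) ∧
      (1 - RsqC X T (yResp X α β σ e)) / (1 - RsqC X γ (yResp X α β σ e)) ≤ 1 + B / D := by
  set v : Fin n → ℝ := fun j => yResp X α β σ e j - (∑ l, yResp X α β σ e l) / n with hv
  set h : ℝ := ∑ i, (hatMatrix (designSub X γ) *ᵥ e) i ^ 2 with hh
  have hh0 : 0 ≤ h := Finset.sum_nonneg fun i _ => sq_nonneg _
  have ha0 : 0 ≤ (∑ l, e l) ^ 2 / n := by positivity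
  have hγT : ∑ i, (residProj X γ *ᵥ v) i ^ 2 ≤ ∑ i, (residProj X T *ᵥ v) i ^ 2 :=
    sum_sq_residProj_mulVec_anti hTγ hγ v
  have eγ : ∑ i, (residProj X γ *ᵥ v) i ^ 2
      = σ ^ 2 * (∑ i, e i ^ 2 - (∑ l, e l) ^ 2 / n - h) := by
    rw [hv, residProj_mulVec_yResp hn horth hTγ hγ α σ hβ e]
    simp only [Pi.smul_apply, smul_eq_mul, mul_pow, ← Finset.mul_sum]
    rw [sum_sq_residProj_mulVec hγ, sum_sq_sub_mean hn, hatMatrix_mulVec_sub_const horth]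
  have eT : ∑ i, (residProj X T *ᵥ v) i ^ 2
      ≤ σ ^ 2 * (∑ i, e i ^ 2 - (∑ l, e l) ^ 2 / n) := by
    rw [hv, residProj_mulVec_yResp hn horth subset_rfl hT α σ hβ e]
    simp only [Pi.smul_apply, smul_eq_mul, mul_pow, ← Finset.mul_sum]
    rw [sum_sq_residProj_mulVec hT, sum_sq_sub_mean hn]
    exact mul_le_mul_of_nonneg_left
      (sub_le_self _ (Finset.sum_nonneg fun i _ => sq_nonneg _)) (sq_nonneg _)
  have hσ2 : 0 < σ ^ 2 := by positivity
  have hpos : 0 < ∑ i, (residProj X γ *ᵥ v) i ^ 2 := by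
    rw [eγ]
    exact mul_pos hσ2 (by linarith)
  have hvpos : 0 < ∑ i, v i ^ 2 := by
    refine hpos.trans_le ?_
    rw [sum_sq_residProj_mulVec hγ]
    exact sub_le_self _ (Finset.sum_nonneg fun i _ => sq_nonneg _)
  have hratio : (1 - RsqC X T (yResp X α β σ e)) / (1 - RsqC X γ (yResp X α β σ e))
      = (∑ i, (residProj X T *ᵥ v) i ^ 2) / ∑ i, (residProj X γ *ᵥ v) i ^ 2 := by
    unfold RsqC
    rw [_root_.sub_sub_cancel, _root_.sub_sub_cancel]
    exact div_div_div_cancel_right₀ hvpos.ne' _ _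
  rw [hratio]
  refine ⟨(one_le_div hpos).2 hγT, ?_⟩
  rw [div_le_iff₀ hpos]
  refine eT.trans ?_
  rw [eγ]
  have hB0 : 0 ≤ B / D := div_nonneg (by linarith) hD.le
  have hle : h ≤ B / D * (∑ i, e i ^ 2 - (∑ l, e l) ^ 2 / n - h) := by
    calc h ≤ B := by linarith
      _ = B / D * D := by field_simp
      _ ≤ _ := mul_le_mul_of_nonneg_left (by linarith) hB0
  nlinarith

end Resid

lemma eventually_isUnit_det_designSub {p : ℕ} {X : (n : ℕ) → Matrix (Fin n) (Fin p) ℝ}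
    {S₀ : Matrix (Fin p) (Fin p) ℝ} (hS₀ : S₀.PosDef)
    (hlim : Tendsto (fun n : ℕ => ((n : ℝ)⁻¹) • ((X n)ᵀ * X n)) atTop (nhds S₀))
    (γ : Finset (Fin p)) :
    ∀ᶠ n in atTop, IsUnit ((designSub (X n) γ)ᵀ * designSub (X n) γ).det := by
  have hpos : (S₀.submatrix ((↑) : {j // j ∈ γ} → Fin p) (↑)).PosDef :=
    hS₀.submatrix Subtype.val_injective
  have hcont : Continuous fun S : Matrix (Fin p) (Fin p) ℝ =>
      (S.submatrix ((↑) : {j // j ∈ γ} → Fin p) (↑)).det := by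
    fun_prop
  have hev := (hcont.tendsto S₀).comp hlim |>.eventually_ne hpos.det_pos.ne'
  filter_upwards [hev] with n hn
  rw [isUnit_iff_ne_zero]
  intro h0
  apply hn
  have e : (((n : ℝ)⁻¹) • ((X n)ᵀ * X n)).submatrix ((↑) : {j // j ∈ γ} → Fin p) (↑)
      = ((n : ℝ)⁻¹) • ((designSub (X n) γ)ᵀ * designSub (X n) γ) := by
    ext i j
    simp [designSub, Matrix.mul_apply]
  simp only [Function.comp_apply]
  rw [e, Matrix.det_smul, h0, mul_zero]

section SecondMoment

variable {Ω ι : Type*} [DecidableEq ι] [MeasurableSpace Ω] {P : Measure Ω}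
  {e : Ω → ι → ℝ}

lemma integrable_mul_of_identity_covariance (hmeas : Measurable e)
    (hcov : ∀ i j, ∫ ω, e ω i * e ω j ∂P = if i = j then 1 else 0) (i j : ι) :
    Integrable (fun ω => e ω i * e ω j) P := by
  have hL : ∀ i, MemLp (fun ω => e ω i) 2 P := fun i => by
    refine (memLp_two_iff_integrable_sq
      ((measurable_pi_apply i).comp hmeas).aestronglyMeasurable).2 ?_
    by_contra hni
    have h := hcov i i
    simp only [← sq, if_true] at h
    exact zero_ne_one ((integral_undef hni).symm.trans h)
  exact (hL i).integrable_mul (hL j)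

lemma integrable_and_integral_sq_linear [Fintype ι] (hmeas : Measurable e)
    (hcov : ∀ i j, ∫ ω, e ω i * e ω j ∂P = if i = j then 1 else 0) (c : ι → ℝ) :
    Integrable (fun ω => (∑ j, c j * e ω j) ^ 2) P ∧
      ∫ ω, (∑ j, c j * e ω j) ^ 2 ∂P = ∑ j, c j ^ 2 := by
  have hint := integrable_mul_of_identity_covariance hmeas hcov
  have hx : (fun ω => (∑ j, c j * e ω j) ^ 2)
      = fun ω => ∑ i, ∑ j, c i * c j * (e ω i * e ω j) := by
    ext ω
    rw [sq, Finset.sum_mul_sum]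
    exact Finset.sum_congr rfl fun i _ => Finset.sum_congr rfl fun j _ => by ring
  rw [hx]
  refine ⟨integrable_finsetSum _ fun i _ => integrable_finsetSum _ fun j _ =>
    (hint i j).const_mul _, ?_⟩
  rw [integral_finsetSum _ fun i _ => integrable_finsetSum _ fun j _ => (hint i j).const_mul _]
  refine Finset.sum_congr rfl fun i _ => ?_
  rw [integral_finsetSum _ fun j _ => (hint i j).const_mul _]
  simp [integral_const_mul, hcov, sq]

end SecondMoment

/-- The squared norm of the projection of the noise on the span of `(1, X_γ)` has expectation
`|γ| + 1`. -/
lemma integrable_and_integral_sq_proj {Ω : Type*} [MeasurableSpace Ω] {P : Measure Ω} {n p : ℕ}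
    (hn : n ≠ 0) {X : Matrix (Fin n) (Fin p) ℝ} {γ : Finset (Fin p)}
    (hγ : IsUnit ((designSub X γ)ᵀ * designSub X γ).det) {e : Ω → Fin n → ℝ}
    (hmeas : Measurable e)
    (hcov : ∀ i j, ∫ ω, e ω i * e ω j ∂P = if i = j then 1 else 0) :
    Integrable (fun ω => (∑ l, e ω l) ^ 2 / n
        + ∑ i, (hatMatrix (designSub X γ) *ᵥ e ω) i ^ 2) P ∧
      ∫ ω, ((∑ l, e ω l) ^ 2 / n + ∑ i, (hatMatrix (designSub X γ) *ᵥ e ω) i ^ 2) ∂P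
        = γ.card + 1 := by
  have hq := integrable_and_integral_sq_linear hmeas hcov
  have h1 := hq fun _ => 1
  simp only [one_mul, one_pow, Finset.sum_const, Finset.card_univ, Fintype.card_fin,
    nsmul_eq_mul, mul_one] at h1
  have h2 : Integrable (fun ω => ∑ i, (hatMatrix (designSub X γ) *ᵥ e ω) i ^ 2) P :=
    integrable_finsetSum _ fun i _ => (hq (hatMatrix (designSub X γ) i)).1
  refine ⟨(h1.1.div_const _).add h2, ?_⟩
  have h3 : ∫ ω, ∑ i, (hatMatrix (designSub X γ) *ᵥ e ω) i ^ 2 ∂P = γ.card := by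
    simp only [Matrix.mulVec, dotProduct]
    rw [integral_finsetSum _ fun i _ => (hq (hatMatrix (designSub X γ) i)).1,
      Finset.sum_congr rfl fun i _ => (hq (hatMatrix (designSub X γ) i)).2,
      sum_sq_hatMatrix hγ, Fintype.card_coe]
  have hn' : (n : ℝ) ≠ 0 := by exact_mod_cast hn
  rw [integral_add (h1.1.div_const _) h2, h3, integral_div, h1.2, div_self hn', add_comm]

/-- **Lemma 3, part 2.** For `γ ⊋ T`: (i) deterministically (where the
`R²`'s are defined) `R_T² ≤ R_γ²`, i.e. `(1-R_T²)/(1-R_γ²) ≥ 1`; (ii) the `n`-th power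
`((1-R_T²)/(1-R_γ²))ⁿ` is bounded in probability, uniformly in large `n`. -/
theorem Rsq_ratio_supset_bounded
    (p : ℕ) (hp : 1 ≤ p)
    (Ω : Type) [MeasurableSpace Ω] (P : Measure Ω) [IsProbabilityMeasure P]
    (X : (n : ℕ) → Matrix (Fin n) (Fin p) ℝ)
    (ε : (n : ℕ) → Ω → Fin n → ℝ)
    (horth : ∀ n j, ∑ i, X n i j = 0)
    (hA2 : ∃ S₀ : Matrix (Fin p) (Fin p) ℝ, S₀.PosDef ∧
      Tendsto (fun n : ℕ => ((n : ℝ)⁻¹) • ((X n)ᵀ * X n)) atTop (nhds S₀))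
    (hmeas : ∀ n, Measurable (ε n))
    (hsph : ∀ (n : ℕ) (O : Matrix (Fin n) (Fin n) ℝ), Oᵀ * O = 1 →
      P.map (fun ω => O.mulVec (ε n ω)) = P.map (ε n))
    (hmean : ∀ n i, ∫ ω, ε n ω i ∂P = 0)
    (hcov : ∀ n i j, ∫ ω, ε n ω i * ε n ω j ∂P = if i = j then 1 else 0)
    (hA1 : ∀ c : ℝ, 0 < c → ∃ M : ℝ, 1 < M ∧ ∀ n : ℕ, 0 < n →
      ENNReal.ofReal (1 - c) <
        P {ω | M⁻¹ < (∑ i, ε n ω i ^ 2) / n ∧ (∑ i, ε n ω i ^ 2) / n < M})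
    (T : Finset (Fin p)) (αT σT : ℝ) (hσ : 0 < σT)
    (βT : Fin p → ℝ) (hβT : ∀ j ∈ T, βT j ≠ 0) (hβT' : ∀ j ∉ T, βT j = 0)
    (γ : Finset (Fin p)) (hγ : T ⊂ γ)
    :
    ((∀ (n : ℕ) (ω : Ω),
        IsUnit ((designSub (X n) γ)ᵀ * designSub (X n) γ).det →
        IsUnit ((designSub (X n) T)ᵀ * designSub (X n) T).det →
        (∑ i, (yResp (X n) αT βT σT (ε n ω) i - (∑ l, yResp (X n) αT βT σT (ε n ω) l) / n) ^ 2) ≠ 0 →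
        RsqC (X n) T (yResp (X n) αT βT σT (ε n ω)) ≤ RsqC (X n) γ (yResp (X n) αT βT σT (ε n ω))) ∧
      ∀ k : ℝ, 0 < k → k < 1 → ∃ C : ℝ, 0 < C ∧ ∃ N : ℕ, ∀ n, N ≤ n →
        ENNReal.ofReal (1 - k) <
          P {ω | 1 ≤ ((1 - RsqC (X n) T (yResp (X n) αT βT σT (ε n ω))) / (1 - RsqC (X n) γ (yResp (X n) αT βT σT (ε n ω)))) ^ n ∧
                 ((1 - RsqC (X n) T (yResp (X n) αT βT σT (ε n ω))) / (1 - RsqC (X n) γ (yResp (X n) αT βT σT (ε n ω)))) ^ n < 1 + C}) := by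
  refine ⟨fun n ω hUγ _ _ => RsqC_mono hγ.1 hUγ _, fun k hk hk1 => ?_⟩
  obtain ⟨S₀, hS₀, hlim⟩ := hA2
  obtain ⟨M, hM, hMP⟩ := hA1 (k / 2) (by linarith)
  have hM0 : 0 < M := by linarith
  set B : ℝ := 2 * (γ.card + 1) / k with hBdef
  have hB0 : 0 < B := by positivity
  obtain ⟨N, hN⟩ := eventually_atTop.1 (((eventually_isUnit_det_designSub hS₀ hlim T).and
    (eventually_isUnit_det_designSub hS₀ hlim γ)).and
      ((eventually_ge_atTop 1).and
        (tendsto_natCast_atTop_atTop.eventually_ge_atTop (2 * M * B))))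
  refine ⟨Real.exp (2 * M * B), Real.exp_pos _, N, fun n hn => ?_⟩
  obtain ⟨⟨hUT, hUγ⟩, hn1, hnB⟩ := hN n hn
  have hn0 : n ≠ 0 := by omega
  have hnpos : (0 : ℝ) < n := by exact_mod_cast hn1
  obtain ⟨hZint, hZ⟩ := integrable_and_integral_sq_proj hn0 hUγ (hmeas n) (hcov n)
  set Z : Ω → ℝ := fun ω => (∑ l, ε n ω l) ^ 2 / n
    + ∑ i, (hatMatrix (designSub (X n) γ) *ᵥ ε n ω) i ^ 2 with hZdef
  have hZ0 : 0 ≤ Z := fun ω =>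
    add_nonneg (by positivity) (Finset.sum_nonneg fun i _ => sq_nonneg _)
  have hmarkov : P {ω | B ≤ Z ω} ≤ ENNReal.ofReal (k / 2) := by
    have h := mul_meas_ge_le_integral_of_nonneg (μ := P) (ae_of_all _ hZ0) hZint B
    rw [hZ] at h
    rw [ENNReal.le_ofReal_iff_toReal_le (measure_ne_top _ _) (by positivity)]
    refine le_of_mul_le_mul_left (h.trans_eq ?_) hB0
    rw [hBdef]
    field_simp
  by_contra! hle
  refine (hMP n hn1).not_ge ?_
  refine (measure_mono (t := _ ∪ {ω | B ≤ Z ω}) ?_).trans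
    ((measure_union_le _ _).trans ((add_le_add hle hmarkov).trans_eq ?_))
  · rintro ω ⟨hω, -⟩
    by_cases hBZ : B ≤ Z ω
    · exact Or.inr hBZ
    refine Or.inl ?_
    rw [lt_div_iff₀ hnpos] at hω
    have hhalf : M⁻¹ * n = n / (2 * M) + n / (2 * M) := by
      field_simp
      ring
    have hBn : B ≤ n / (2 * M) := by
      rw [le_div_iff₀ (by positivity)]
      linarith
    obtain ⟨hlo, hhi⟩ := RsqC_ratio_bounds hn0 (horth n) hγ.1 hUT hUγ αT hσ hβT' (ε n ω)
      (B := B) (D := n / (2 * M)) (by positivity) (not_le.1 hBZ).le (by linarith)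
    refine ⟨one_le_pow₀ hlo, ?_⟩
    have hexp : 1 + B / (n / (2 * M)) ≤ Real.exp (2 * M * B / n) := by
      have h := Real.add_one_le_exp (2 * M * B / n)
      have e : B / (n / (2 * M)) = 2 * M * B / n := by field_simp
      linarith
    have hpow := pow_le_pow_left₀ (zero_le_one.trans hlo) (hhi.trans hexp) n
    rw [← Real.exp_nat_mul, mul_div_cancel₀ _ hnpos.ne'] at hpow
    linarith
  · rw [← ENNReal.ofReal_add (by linarith) (by linarith)]
    congr 1
    ring
end
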